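/- arXiv:2306.15276 — 2 statements merged into one kernel-verified Lean document; each statement's English description precedes it below -/
import Mathlib

section
/- Under the hypotheses of the constructions of P_A and P_B, set P = P_A ∪ P_B (so |P| = 2k) and let P_C ⊆ P with |P_C| = k. If there exists an index h ∈ {1,…,k} with p_h ∉ P_C and p_{k+h} ∉ P_C, then there is an anchored box containing no point of P_C whose volume is strictly greater than 1 − α; consequently d*∞(P_C) > 1 − α. -/
open scoped Classical

noncomputable section

/-- The volume (Lebesgue measure) of the anchored box `[0, q)` (equivalently `[0,q]`). -/
def vol {d : ℕ} (q : Fin d → ℝ) : ℝ := ∏ j, q j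

/-- `x` lies in the open anchored box `[0, q) = ∏_j [0, q_j)`. -/
def inOpenBox {d : ℕ} (q x : Fin d → ℝ) : Prop := ∀ j, 0 ≤ x j ∧ x j < q j

/-- `x` lies in the closed anchored box `[0, q] = ∏_j [0, q_j]`. -/
def inClosedBox {d : ℕ} (q x : Fin d → ℝ) : Prop := ∀ j, 0 ≤ x j ∧ x j ≤ q j

/-- `δ(q, P) = λ(q) - D(q, P) / |P|`, using the open box `[0, q)`. -/
def delta {d : ℕ} (q : Fin d → ℝ) (P : Finset (Fin d → ℝ)) : ℝ :=
  vol q - ((P.filter (fun x => inOpenBox q x)).card : ℝ) / (P.card : ℝ)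

/-- `δ̄(q, P) = D̄(q, P) / |P| - λ(q)`, using the closed box `[0, q]`. -/
def deltaBar {d : ℕ} (q : Fin d → ℝ) (P : Finset (Fin d → ℝ)) : ℝ :=
  ((P.filter (fun x => inClosedBox q x)).card : ℝ) / (P.card : ℝ) - vol q

/-- The `L∞` star discrepancy `d*∞(P) = sup_{q ∈ [0,1]^d} max (δ(q,P)) (δ̄(q,P))`. -/
def starDisc {d : ℕ} (P : Finset (Fin d → ℝ)) : ℝ :=
  sSup {x : ℝ | ∃ q : Fin d → ℝ,
    (∀ j, 0 ≤ q j ∧ q j ≤ 1) ∧ x = max (delta q P) (deltaBar q P)}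

/-- The points `p_i = (q_{i,1}, q_{i+1,2})` of the construction (0-indexed: the paper's
`p_{i+1}` is `pA q i` for `0 ≤ i ≤ k-1`). -/
def pA (q : ℕ → Fin 2 → ℝ) (i : ℕ) : Fin 2 → ℝ := ![q i 0, q (i + 1) 1]

/-- The point set `P_A = {p_1, …, p_k}`. -/
def PA (k : ℕ) (q : ℕ → Fin 2 → ℝ) : Finset (Fin 2 → ℝ) :=
  (Finset.range k).image (pA q)

/-- The points of the construction of `P_B` (0-indexed: the paper's `p_{k+i}` is
`pB q γ δ (i-1)` for `1 ≤ i ≤ k`): `p_{k+1} = (q_{1,1} - γ, q_{2,2} - δ)` and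
`p_{k+i} = (q_{i,1}, q_{i+1,2} - δ)` for `2 ≤ i ≤ k`. -/
def pB (q : ℕ → Fin 2 → ℝ) (γ δ : ℝ) (m : ℕ) : Fin 2 → ℝ :=
  if m = 0 then ![q 0 0 - γ, q 1 1 - δ] else ![q m 0, q (m + 1) 1 - δ]

/-- The point set `P_B = {p_{k+1}, …, p_{2k}}`. -/
def PB (k : ℕ) (q : ℕ → Fin 2 → ℝ) (γ δ : ℝ) : Finset (Fin 2 → ℝ) :=
  (Finset.range k).image (pB q γ δ)

lemma vol_nonneg_of_mem {d : ℕ} {q : Fin d → ℝ} (hq : ∀ j, 0 ≤ q j ∧ q j ≤ 1) : 0 ≤ vol q :=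
  Finset.prod_nonneg fun j _ => (hq j).1

lemma vol_le_one_of_mem {d : ℕ} {q : Fin d → ℝ} (hq : ∀ j, 0 ≤ q j ∧ q j ≤ 1) : vol q ≤ 1 :=
  Finset.prod_le_one (fun j _ => (hq j).1) fun j _ => (hq j).2

lemma delta_le_one {d : ℕ} {q : Fin d → ℝ} (hq : ∀ j, 0 ≤ q j ∧ q j ≤ 1)
    (P : Finset (Fin d → ℝ)) : delta q P ≤ 1 := by
  have h : 0 ≤ ((P.filter (fun x => inOpenBox q x)).card : ℝ) / (P.card : ℝ) := by positivity
  have := vol_le_one_of_mem hq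
  unfold delta
  linarith

lemma deltaBar_le_one {d : ℕ} {q : Fin d → ℝ} (hq : ∀ j, 0 ≤ q j ∧ q j ≤ 1)
    (P : Finset (Fin d → ℝ)) : deltaBar q P ≤ 1 := by
  have h : ((P.filter (fun x => inClosedBox q x)).card : ℝ) / (P.card : ℝ) ≤ 1 :=
    div_le_one_of_le₀ (by exact_mod_cast Finset.card_filter_le _ _) (by positivity)
  have := vol_nonneg_of_mem hq
  unfold deltaBar
  linarith

/-- The star discrepancy is at least the volume of any empty anchored box. -/
lemma vol_le_starDisc_of_empty {d : ℕ} {c : Fin d → ℝ} (hc : ∀ j, 0 ≤ c j ∧ c j ≤ 1)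
    {P : Finset (Fin d → ℝ)} (hP : ∀ x ∈ P, ¬ inOpenBox c x) : vol c ≤ starDisc P := by
  have hdelta : delta c P = vol c := by
    simp [delta, Finset.filter_false_of_mem hP]
  have hbdd : BddAbove {x : ℝ | ∃ q : Fin d → ℝ,
      (∀ j, 0 ≤ q j ∧ q j ≤ 1) ∧ x = max (delta q P) (deltaBar q P)} := by
    refine ⟨1, ?_⟩
    rintro x ⟨q, hq, rfl⟩
    exact max_le (delta_le_one hq P) (deltaBar_le_one hq P)
  exact (hdelta ▸ le_max_left _ _ : vol c ≤ max (delta c P) (deltaBar c P)).trans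
    (le_csSup hbdd ⟨c, hc, rfl⟩)

/-- Under the constructions of `P_A` and `P_B`, let `P = P_A ∪ P_B` and `P_C ⊆ P` with
`|P_C| = k`. If for some `h` (0-indexed, the paper's `h+1 ∈ {1,…,k}`) neither `p_{h+1}`
nor `p_{k+h+1}` belongs to `P_C`, then there is an anchored box containing no point of
`P_C` of volume strictly greater than `1 - α`; consequently `d*∞(P_C) > 1 - α`. -/
theorem large_empty_box_of_dropped_pair (k : ℕ) (hk : 2 ≤ k)
    (α : ℝ) (hα0 : 0 < α) (hα1 : α < 1 / (2 * k))
    (q : ℕ → Fin 2 → ℝ)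
    (hq_mem : ∀ i ≤ k, ∀ j, 0 < q i j ∧ q i j ≤ 1)
    (hq_curve : ∀ i ≤ k, q i 0 * q i 1 = 1 - α)
    (hq_first : q 0 1 = 1) (hq_last : q k 0 = 1)
    (hq_mono : ∀ i < k, q i 0 < q (i + 1) 0)
    (hq_gt : ∀ i < k, 1 - 1 / (2 * k) < q i 0 * q (i + 1) 1)
    (δ γ : ℝ) (hδ0 : 0 < δ) (hγ0 : 0 < γ)
    (hδ_gap : ∀ i, 1 ≤ i → i < k → δ < q i 1 - q (i + 1) 1)
    (hδ_hyp : ∀ i, 1 ≤ i → i < k → 1 - 1 / (k : ℝ) ≤ q i 0 * (q (i + 1) 1 - δ))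
    (hγ_lt : γ < q 0 0)
    (hγδ_hyp : 1 - 1 / (k : ℝ) ≤ (q 0 0 - γ) * (q 1 1 - δ))
    (PC : Finset (Fin 2 → ℝ)) (hPC : PC ⊆ PA k q ∪ PB k q γ δ) (hPCcard : PC.card = k)
    (h : ℕ) (hhk : h < k) (hA : pA q h ∉ PC) (hB : pB q γ δ h ∉ PC) :
    (∃ c : Fin 2 → ℝ, (∀ j, 0 ≤ c j ∧ c j ≤ 1) ∧
      (∀ x ∈ PC, ¬ inOpenBox c x) ∧ 1 - α < vol c) ∧
    1 - α < starDisc PC := by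
  suffices hbox : ∃ c : Fin 2 → ℝ, (∀ j, 0 ≤ c j ∧ c j ≤ 1) ∧
      (∀ x ∈ PC, ¬ inOpenBox c x) ∧ 1 - α < vol c by
    obtain ⟨c, hc, hempty, hvol⟩ := hbox
    exact ⟨⟨c, hc, hempty, hvol⟩, hvol.trans_le (vol_le_starDisc_of_empty hc hempty)⟩
  have hmono : ∀ i j, i ≤ j → j ≤ k → q i 0 ≤ q j 0 := by
    intro i j hij
    induction j, hij using Nat.le_induction with
    | base => exact fun _ => le_rfl
    | succ j _ ih => exact fun hj => (ih (by omega)).trans (hq_mono j (by omega)).le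
  have hanti : ∀ i j, i ≤ j → j ≤ k → q j 1 ≤ q i 1 := by
    intro i j hij hj
    by_contra! hlt
    have hi0 := (hq_mem i (hij.trans hj) 0).1
    have hj1 := (hq_mem j hj 1).1
    have hcurve := (hq_curve i (hij.trans hj)).trans (hq_curve j hj).symm
    nlinarith [mul_le_mul_of_nonneg_right (hmono i j hij hj) hj1.le,
      mul_lt_mul_of_pos_left hlt hi0]
  have hempty : ∀ y : ℝ, (∀ i < h, y ≤ q (i + 1) 1 - δ) →
      ∀ x ∈ PC, ¬ inOpenBox ![q (h + 1) 0, y] x := by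
    intro y hy x hx hin
    have hx0 : x 0 < q (h + 1) 0 := by simpa using (hin 0).2
    have hx1 : x 1 < y := by simpa using (hin 1).2
    rcases Finset.mem_union.1 (hPC hx) with hx' | hx' <;>
      obtain ⟨i, hi, rfl⟩ := Finset.mem_image.1 hx' <;>
      rw [Finset.mem_range] at hi <;>
      rcases lt_trichotomy i h with hih | rfl | hih
    · have hyi := hy i hih
      simp only [pA, Matrix.cons_val_one, Matrix.cons_val_fin_one] at hx1
      linarith
    · exact hA hx
    · have := hmono (h + 1) i hih hi.le
      simp only [pA, Matrix.cons_val_zero] at hx0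
      linarith
    · have hyi := hy i hih
      unfold pB at hx1
      split_ifs at hx1 with hi0
      · subst hi0
        simp only [Matrix.cons_val_one, Matrix.cons_val_fin_one] at hx1
        norm_num at hyi
        linarith
      · simp only [Matrix.cons_val_one, Matrix.cons_val_fin_one] at hx1
        linarith
    · exact hB hx
    · have := hmono (h + 1) i hih hi.le
      simp only [pB, if_neg (show i ≠ 0 by omega), Matrix.cons_val_zero] at hx0
      linarith
  have ha := hq_mem (h + 1) hhk 0
  have hcurve := hq_curve (h + 1) hhk
  rcases Nat.eq_zero_or_pos h with rfl | hpos
  · refine ⟨![q 1 0, 1], ?_, hempty 1 (by simp), ?_⟩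
    · rw [Fin.forall_fin_two]
      exact ⟨⟨ha.1.le, ha.2⟩, by simp⟩
    · have h0 := hq_curve 0 (Nat.zero_le k)
      have h1 := hq_mono 0 hhk
      rw [hq_first, mul_one] at h0
      simpa [vol, Fin.prod_univ_two, ← h0] using h1
  · have hgap := hδ_gap h hpos hhk
    have hb := hq_mem (h + 1) hhk 1
    have hb' := hq_mem h hhk.le 1
    refine ⟨![q (h + 1) 0, q h 1 - δ], ?_, hempty _ fun i hi => ?_, ?_⟩
    · rw [Fin.forall_fin_two]
      refine ⟨⟨ha.1.le, ha.2⟩, ?_⟩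
      simp only [Matrix.cons_val_one, Matrix.cons_val_fin_one]
      constructor <;> linarith
    · linarith [hanti (i + 1) h hi hhk.le]
    · simp only [vol, Fin.prod_univ_two, Matrix.cons_val_zero, Matrix.cons_val_one,
        Matrix.cons_val_fin_one]
      rw [← hcurve]
      exact mul_lt_mul_of_pos_left (by linarith) ha.1
end
end

section
/- Under the hypotheses of the constructions of P_A and P_B, set P = P_A ∪ P_B (so |P| = 2k). Then every subset P_C ⊆ P with |P_C| = k and P_C ∩ P_A ≠ ∅ satisfies d*∞(P_C) ≥ 1 − α = d*∞(P_A). Consequently, P_A is a local minimum for (k−1)-swaps of the star discrepancy subset selection problem with parameter k on P, but it is not a global minimum, since d*∞(P_B) < 1 − α. -/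
open scoped Classical

noncomputable section

theorem vol_mono {d : ℕ} {a x : Fin d → ℝ} (h : inClosedBox a x) : vol x ≤ vol a :=
  Finset.prod_le_prod (fun j _ => (h j).1) (fun j _ => (h j).2)

theorem vol_nonneg {d : ℕ} {a : Fin d → ℝ} (h : ∀ j, 0 ≤ a j ∧ a j ≤ 1) : 0 ≤ vol a :=
  Finset.prod_nonneg (fun j _ => (h j).1)

theorem vol_le_one {d : ℕ} {a : Fin d → ℝ} (h : ∀ j, 0 ≤ a j ∧ a j ≤ 1) : vol a ≤ 1 :=
  Finset.prod_le_one (fun j _ => (h j).1) (fun j _ => (h j).2)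

theorem card_filter_div_le_one {β : Type*} (P : Finset β) (p : β → Prop) :
    ((P.filter p).card : ℝ) / (P.card : ℝ) ≤ 1 :=
  div_le_one_of_le₀ (by exact_mod_cast Finset.card_filter_le P p) (by positivity)

theorem delta_le_vol {d : ℕ} (a : Fin d → ℝ) (P : Finset (Fin d → ℝ)) : delta a P ≤ vol a :=
  sub_le_self _ (by positivity)

theorem deltaBar_le_one_sub_vol {d : ℕ} (a : Fin d → ℝ) (P : Finset (Fin d → ℝ)) :
    deltaBar a P ≤ 1 - vol a :=
  sub_le_sub_right (card_filter_div_le_one P _) _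

theorem delta_eq_vol {d : ℕ} {a : Fin d → ℝ} {P : Finset (Fin d → ℝ)}
    (h : ∀ x ∈ P, ¬ inOpenBox a x) : delta a P = vol a := by
  simp [delta, Finset.filter_false_of_mem h]

/-- The discrepancy at any corner of the unit cube is at most the star discrepancy. -/
theorem delta_le_starDisc {d : ℕ} {a : Fin d → ℝ} (P : Finset (Fin d → ℝ))
    (ha : ∀ j, 0 ≤ a j ∧ a j ≤ 1) : delta a P ≤ starDisc P := by
  refine (le_max_left _ (deltaBar a P)).trans (le_csSup ⟨1, ?_⟩ ⟨a, ha, rfl⟩)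
  rintro _ ⟨b, hb, rfl⟩
  refine max_le ((delta_le_vol b P).trans (vol_le_one hb)) ?_
  linarith [deltaBar_le_one_sub_vol b P, vol_nonneg hb]

/-- If all empty boxes have volume at most `c` and all points span boxes of volume at least
`1 - c`, then the star discrepancy is at most `c`, provided `1 - 1 / |P| ≤ c`. -/
theorem starDisc_le {d : ℕ} {P : Finset (Fin d → ℝ)} {c : ℝ} (hc : 0 ≤ c)
    (hcard : 1 - 1 / (P.card : ℝ) ≤ c) (hpts : ∀ x ∈ P, 1 - c ≤ vol x)
    (hempty : ∀ a : Fin d → ℝ, (∀ j, 0 ≤ a j ∧ a j ≤ 1) → (∀ x ∈ P, ¬ inOpenBox a x) →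
      vol a ≤ c) :
    starDisc P ≤ c := by
  refine csSup_le ⟨_, 0, by simp, rfl⟩ ?_
  rintro _ ⟨a, ha, rfl⟩
  refine max_le ?_ ?_
  · by_cases h : ∀ x ∈ P, ¬ inOpenBox a x
    · exact (delta_le_vol a P).trans (hempty a ha h)
    · push Not at h
      obtain ⟨x, hx, hxa⟩ := h
      have h1 : 1 ≤ (P.filter (fun x => inOpenBox a x)).card :=
        Finset.card_pos.mpr ⟨x, Finset.mem_filter.mpr ⟨hx, hxa⟩⟩
      have h2 : 1 / (P.card : ℝ) ≤
          ((P.filter (fun x => inOpenBox a x)).card : ℝ) / (P.card : ℝ) := by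
        gcongr
        exact_mod_cast h1
      have h3 := vol_le_one ha
      unfold delta
      linarith
  · by_cases h : ∀ x ∈ P, ¬ inClosedBox a x
    · have h1 := vol_nonneg ha
      simp only [deltaBar, Finset.filter_false_of_mem h, Finset.card_empty, Nat.cast_zero,
        zero_div]
      linarith
    · push Not at h
      obtain ⟨x, hx, hxa⟩ := h
      linarith [deltaBar_le_one_sub_vol a P, vol_mono hxa, hpts x hx]

theorem exists_lt_le_succ {X : ℕ → ℝ} {k : ℕ} {a : ℝ} (h0 : X 0 < a) (hk : a ≤ X k) :
    ∃ m < k, X m < a ∧ a ≤ X (m + 1) := by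
  induction k with
  | zero => exact absurd hk (not_le.mpr h0)
  | succ n ih =>
    by_cases h : a ≤ X n
    · obtain ⟨m, hm, hma⟩ := ih h
      exact ⟨m, by omega, hma⟩
    · exact ⟨n, by omega, not_le.mp h, hk⟩

theorem lt_of_lt_succ_upto {X : ℕ → ℝ} {k : ℕ} (h : ∀ i < k, X i < X (i + 1)) {i j : ℕ}
    (hij : i < j) (hj : j ≤ k) : X i < X j := by
  induction j, hij using Nat.le_induction with
  | base => exact h i hj
  | succ n hn ih => exact (ih (by omega)).trans (h n hj)

theorem inOpenBox_fin_two {a x : Fin 2 → ℝ} :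
    inOpenBox a x ↔ (0 ≤ x 0 ∧ x 0 < a 0) ∧ (0 ≤ x 1 ∧ x 1 < a 1) := Fin.forall_fin_two

theorem vol_fin_two (a : Fin 2 → ℝ) : vol a = a 0 * a 1 := Fin.prod_univ_two a

@[simp] theorem pA_zero (q : ℕ → Fin 2 → ℝ) (i : ℕ) : pA q i 0 = q i 0 := rfl

@[simp] theorem pA_one (q : ℕ → Fin 2 → ℝ) (i : ℕ) : pA q i 1 = q (i + 1) 1 := rfl

theorem pB_zero (q : ℕ → Fin 2 → ℝ) (γ δ : ℝ) (m : ℕ) :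
    pB q γ δ m 0 = if m = 0 then q 0 0 - γ else q m 0 := by
  unfold pB; split_ifs <;> rfl

@[simp] theorem pB_one (q : ℕ → Fin 2 → ℝ) (γ δ : ℝ) (m : ℕ) :
    pB q γ δ m 1 = q (m + 1) 1 - δ := by
  unfold pB; split_ifs with h
  · subst h; rfl
  · rfl

/-- Under the constructions of `P_A` and `P_B`, with `P = P_A ∪ P_B` (of size `2k`),
every `k`-element subset `P_C ⊆ P` meeting `P_A` satisfies `d*∞(P_C) ≥ 1 - α = d*∞(P_A)`.
Consequently `P_A` is a local minimum for `(k-1)`-swaps of the star discrepancy subset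
selection problem with parameter `k` on `P`, but not a global minimum, since
`d*∞(P_B) < 1 - α`. -/
theorem PA_local_min_not_global (k : ℕ) (hk : 2 ≤ k)
    (α : ℝ) (hα0 : 0 < α) (hα1 : α < 1 / (2 * k))
    (q : ℕ → Fin 2 → ℝ)
    (hq_mem : ∀ i ≤ k, ∀ j, 0 < q i j ∧ q i j ≤ 1)
    (hq_curve : ∀ i ≤ k, q i 0 * q i 1 = 1 - α)
    (hq_first : q 0 1 = 1) (hq_last : q k 0 = 1)
    (hq_mono : ∀ i < k, q i 0 < q (i + 1) 0)
    (hq_gt : ∀ i < k, 1 - 1 / (2 * k) < q i 0 * q (i + 1) 1)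
    (δ γ : ℝ) (hδ0 : 0 < δ) (hγ0 : 0 < γ)
    (hδ_gap : ∀ i, 1 ≤ i → i < k → δ < q i 1 - q (i + 1) 1)
    (hδ_hyp : ∀ i, 1 ≤ i → i < k → 1 - 1 / (k : ℝ) ≤ q i 0 * (q (i + 1) 1 - δ))
    (hγ_lt : γ < q 0 0)
    (hγδ_hyp : 1 - 1 / (k : ℝ) ≤ (q 0 0 - γ) * (q 1 1 - δ)) :
    (PA k q ∪ PB k q γ δ).card = 2 * k ∧
    (∀ PC ⊆ PA k q ∪ PB k q γ δ, PC.card = k → (PC ∩ PA k q).Nonempty →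
      1 - α ≤ starDisc PC) ∧
    starDisc (PA k q) = 1 - α ∧
    (∀ Q' ⊆ PA k q ∪ PB k q γ δ, Q'.card = k → (PA k q \ Q').card ≤ k - 1 →
      starDisc (PA k q) ≤ starDisc Q') ∧
    ¬ (∀ Q' ⊆ PA k q ∪ PB k q γ δ, Q'.card = k → starDisc (PA k q) ≤ starDisc Q') ∧
    starDisc (PB k q γ δ) < 1 - α := by
  have hk0 : (2 : ℝ) ≤ k := by exact_mod_cast hk
  have hkinv : 1 / (k : ℝ) = 2 * (1 / (2 * k)) := by field_simp
  have hkhalf : 1 / (2 * (k : ℝ)) ≤ 1 / 4 := by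
    apply one_div_le_one_div_of_le <;> linarith
  have hxmono : ∀ {i j}, i < j → j ≤ k → q i 0 < q j 0 := fun hij hj =>
    lt_of_lt_succ_upto (X := fun i => q i 0) hq_mono hij hj
  have hymono : ∀ {i j}, i < j → j ≤ k → q j 1 < q i 1 := by
    intro i j hij hj
    have h1 := hxmono hij hj
    have h2 := hq_curve i (by omega)
    have h3 := hq_curve j hj
    have h4 := (hq_mem i (by omega) 0).1
    have h5 := (hq_mem j hj 1).1
    by_contra! h
    nlinarith
  have hxle : ∀ {i j}, i ≤ j → j ≤ k → q i 0 ≤ q j 0 := by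
    intro i j hij hj
    rcases hij.eq_or_lt with rfl | h
    exacts [le_rfl, (hxmono h hj).le]
  have hyle : ∀ {i j}, i ≤ j → j ≤ k → q j 1 ≤ q i 1 := by
    intro i j hij hj
    rcases hij.eq_or_lt with rfl | h
    exacts [le_rfl, (hymono h hj).le]
  have hx0 : q 0 0 = 1 - α := by simpa [hq_first] using hq_curve 0 (by omega)
  have hq_cube : ∀ i ≤ k, ∀ j, 0 ≤ q i j ∧ q i j ≤ 1 := fun i hi j =>
    ⟨(hq_mem i hi j).1.le, (hq_mem i hi j).2⟩
  have hBx_pos : ∀ m < k, 0 < pB q γ δ m 0 := by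
    intro m hm
    rw [pB_zero]
    split_ifs
    exacts [by linarith, (hq_mem m (by omega) 0).1]
  have hBvol : ∀ m < k, 1 - 1 / (k : ℝ) ≤ pB q γ δ m 0 * pB q γ δ m 1 := by
    intro m hm
    rw [pB_zero, pB_one]
    split_ifs with h
    · subst h; exact hγδ_hyp
    · exact hδ_hyp m (by omega) hm
  have hBy_pos : ∀ m < k, 0 < pB q γ δ m 1 := fun m hm =>
    pos_of_mul_pos_right (by linarith [hBvol m hm]) (hBx_pos m hm).le
  have hBx_le : ∀ m, pB q γ δ m 0 ≤ q m 0 := by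
    intro m
    rw [pB_zero]
    split_ifs with h
    · subst h; linarith
    · exact le_rfl
  have hBx_mono : ∀ {i j}, i < j → j < k → pB q γ δ i 0 < pB q γ δ j 0 := by
    intro i j hij hj
    rw [pB_zero q γ δ j, if_neg (by omega)]
    exact (hBx_le i).trans_lt (hxmono hij hj.le)
  have hA_inj : Set.InjOn (pA q) (Finset.range k) := by
    intro i hi j hj h
    simp only [Finset.coe_range, Set.mem_Iio] at hi hj
    have h0 : q i 0 = q j 0 := congrFun h 0
    rcases lt_trichotomy i j with hij | hij | hij
    exacts [absurd h0 (hxmono hij hj.le).ne, hij, absurd h0 (hxmono hij hi.le).ne']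
  have hB_inj : Set.InjOn (pB q γ δ) (Finset.range k) := by
    intro i hi j hj h
    simp only [Finset.coe_range, Set.mem_Iio] at hi hj
    have h0 := congrFun h 0
    rcases lt_trichotomy i j with hij | hij | hij
    exacts [absurd h0 (hBx_mono hij hj).ne, hij, absurd h0 (hBx_mono hij hi).ne']
  have hA_card : (PA k q).card = k := by
    rw [PA, Finset.card_image_of_injOn hA_inj, Finset.card_range]
  have hB_card : (PB k q γ δ).card = k := by
    rw [PB, Finset.card_image_of_injOn hB_inj, Finset.card_range]
  have hdisj : Disjoint (PA k q) (PB k q γ δ) := by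
    rw [Finset.disjoint_left]
    intro x hxA hxB
    simp only [PA, PB, Finset.mem_image, Finset.mem_range] at hxA hxB
    obtain ⟨i, hi, rfl⟩ := hxA
    obtain ⟨m, hm, h⟩ := hxB
    have h0 := congrFun h 0
    have h1 := congrFun h 1
    rw [pB_zero, pA_zero] at h0
    rw [pB_one, pA_one] at h1
    split_ifs at h0
    · linarith [hxle (Nat.zero_le i) hi.le]
    · rcases lt_trichotomy i m with him | him | him
      · linarith [hxmono him hm.le]
      · subst him; linarith
      · linarith [hxmono him hi.le]
  have hA_empty : ∀ i ≤ k, ∀ j < k, ¬ inOpenBox (q i) (pA q j) := by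
    intro i hi j hj h
    rw [inOpenBox_fin_two, pA_zero, pA_one] at h
    rcases lt_or_ge j i with hij | hij
    · linarith [hyle (show j + 1 ≤ i from hij) hi]
    · linarith [hxle hij hj.le]
  have hB_empty : ∀ m < k, ∀ j < k, j ≠ m → ¬ inOpenBox (q (m + 1)) (pB q γ δ j) := by
    intro m hm j hj hjm h
    rw [inOpenBox_fin_two, pB_zero, pB_one] at h
    rcases lt_or_gt_of_ne hjm with hlt | hgt
    · linarith [hδ_gap (j + 1) (by omega) (by omega),
        hyle (show j + 1 + 1 ≤ m + 1 by omega) (by omega)]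
    · rw [if_neg (by omega)] at h
      linarith [hxle (show m + 1 ≤ j from hgt) hj.le]
  have hlower : ∀ PC ⊆ PA k q ∪ PB k q γ δ, PC.card = k → (PC ∩ PA k q).Nonempty →
      1 - α ≤ starDisc PC := by
    rintro PC hsub hcard ⟨z, hz⟩
    rw [Finset.mem_inter] at hz
    have hnot : ¬ PB k q γ δ ⊆ PC := by
      intro h
      rw [← Finset.eq_of_subset_of_card_le h (by omega)] at hz
      exact Finset.disjoint_left.mp hdisj hz.2 hz.1
    obtain ⟨p, hpB, hpC⟩ := Finset.not_subset.mp hnot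
    simp only [PB, Finset.mem_image, Finset.mem_range] at hpB
    obtain ⟨m, hm, rfl⟩ := hpB
    have hempty : ∀ x ∈ PC, ¬ inOpenBox (q (m + 1)) x := by
      intro x hx
      have hx' := hsub hx
      simp only [PA, PB, Finset.mem_union, Finset.mem_image, Finset.mem_range] at hx'
      rcases hx' with ⟨j, hj, rfl⟩ | ⟨j, hj, rfl⟩
      · exact hA_empty _ hm j hj
      · refine hB_empty m hm j hj ?_
        rintro rfl
        exact hpC hx
    have h := delta_le_starDisc PC (hq_cube (m + 1) hm)
    rwa [delta_eq_vol hempty, vol_fin_two, hq_curve _ hm] at h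
  have hA_nonempty : (PA k q).Nonempty := Finset.card_pos.mp (by omega)
  have hA_le : starDisc (PA k q) ≤ 1 - α := by
    refine starDisc_le (by linarith) (by rw [hA_card]; linarith) ?_ ?_
    · intro x hx
      simp only [PA, Finset.mem_image, Finset.mem_range] at hx
      obtain ⟨i, hi, rfl⟩ := hx
      rw [vol_fin_two, pA_zero, pA_one]
      linarith [hq_gt i hi]
    · intro a ha hempty
      rw [vol_fin_two]
      by_contra! hlt
      have ha0 := ha 0
      have ha1 := ha 1
      obtain ⟨m, hm, hma, ham⟩ := exists_lt_le_succ (X := fun i => q i 0) (k := k) (a := a 0)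
        (by simp only [hx0]; nlinarith) (by simp only [hq_last]; exact ha0.2)
      refine hempty (pA q m) (Finset.mem_image_of_mem _ (Finset.mem_range.mpr hm)) ?_
      rw [inOpenBox_fin_two, pA_zero, pA_one]
      refine ⟨⟨(hq_cube m hm.le 0).1, hma⟩, (hq_cube (m + 1) hm 1).1, ?_⟩
      by_contra! h
      have h1 := hq_curve (m + 1) hm
      have h2 : a 0 * a 1 ≤ q (m + 1) 0 * q (m + 1) 1 :=
        mul_le_mul ham h ha1.1 (hq_cube (m + 1) hm 0).1
      linarith
  have hA_eq : starDisc (PA k q) = 1 - α :=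
    le_antisymm hA_le (hlower _ Finset.subset_union_left hA_card (by simpa using hA_nonempty))
  have hB_lt : starDisc (PB k q γ δ) < 1 - α := by
    have hx0_pos := (hq_mem 0 (by omega) 0).1
    have hε : 0 < min γ (q 0 0 * δ) := lt_min hγ0 (by positivity)
    have hc : max (1 - 1 / (k : ℝ)) (1 - α - min γ (q 0 0 * δ)) < 1 - α :=
      max_lt (by linarith) (by linarith)
    have hc1 := le_max_left (1 - 1 / (k : ℝ)) (1 - α - min γ (q 0 0 * δ))
    refine lt_of_le_of_lt (starDisc_le (by linarith) (by rwa [hB_card]) ?_ ?_) hc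
    · intro x hx
      simp only [PB, Finset.mem_image, Finset.mem_range] at hx
      obtain ⟨i, hi, rfl⟩ := hx
      rw [vol_fin_two]
      linarith [hBvol i hi]
    · intro a ha hempty
      refine le_max_of_le_right ?_
      rw [vol_fin_two]
      have ha0 := ha 0
      have ha1 := ha 1
      rcases le_or_gt (a 0) (q 0 0 - γ) with h | h
      · have h1 : a 0 * a 1 ≤ a 0 := mul_le_of_le_one_right ha0.1 ha1.2
        linarith [min_le_left γ (q 0 0 * δ)]
      · obtain ⟨m, hm, hma, ham⟩ := exists_lt_le_succ (X := fun i => pB q γ δ i 0) (k := k)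
          (a := a 0) (by simpa [pB_zero] using h)
          (by simp only [pB_zero, if_neg (show k ≠ 0 by omega), hq_last]; exact ha0.2)
        have h1 : a 1 ≤ q (m + 1) 1 - δ := by
          by_contra! h2
          refine hempty (pB q γ δ m) (Finset.mem_image_of_mem _ (Finset.mem_range.mpr hm)) ?_
          rw [inOpenBox_fin_two]
          exact ⟨⟨(hBx_pos m hm).le, hma⟩, (hBy_pos m hm).le, by rwa [pB_one]⟩
        have h2 : a 0 * a 1 ≤ q (m + 1) 0 * (q (m + 1) 1 - δ) :=
          mul_le_mul (ham.trans (hBx_le _)) h1 ha1.1 (hq_cube (m + 1) hm 0).1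
        have h3 : q 0 0 * δ ≤ q (m + 1) 0 * δ :=
          mul_le_mul_of_nonneg_right (hxle (Nat.zero_le _) hm) hδ0.le
        linarith [min_le_right γ (q 0 0 * δ), hq_curve (m + 1) hm]
  refine ⟨?_, hlower, hA_eq, ?_, ?_, hB_lt⟩
  · rw [Finset.card_union_of_disjoint hdisj, hA_card, hB_card, two_mul]
  · intro Q' hsub hcard hswap
    rw [hA_eq]
    refine hlower Q' hsub hcard ?_
    by_contra! h
    rw [Finset.sdiff_eq_self_of_disjoint
      (Finset.disjoint_iff_inter_eq_empty.mpr h).symm] at hswap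
    omega
  · intro h
    have := h _ Finset.subset_union_right hB_card
    linarith
end
end
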